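/- arXiv:2402.16544 — 5 statements merged into one kernel-verified Lean document; each statement's English description precedes it below -/
import Mathlib

section
/- Let c ≤ n, let G range over real c×n matrices satisfying G Gᵀ = I_c, and let P be a real n×c matrix with singular value decomposition P = Λ S Vᵀ, where Λ is an n×n orthogonal matrix, V is a c×c orthogonal matrix, and S is the n×c matrix whose only nonzero entries are the singular values s₁₁ ≥ s₂₂ ≥ … ≥ s_cc ≥ 0 on its diagonal. Then the matrix G* = V [I_c, 0] Λᵀ satisfies G* (G*)ᵀ = I_c and maximizes tr(G P) over all c×n matrices G with G Gᵀ = I_c; that is, for every such G, tr(G P) ≤ tr(G* P). -/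
open Matrix BigOperators

/-- The `c × n` matrix `[I_c, 0]` obtained by appending `n - c` zero columns to the
`c × c` identity matrix. -/
def rectId (c n : ℕ) : Matrix (Fin c) (Fin n) ℝ :=
  Matrix.of fun i j => if (i : ℕ) = (j : ℕ) then (1 : ℝ) else 0

theorem aux_trace (n c : ℕ) (hcn : c ≤ n) (S : Matrix (Fin n) (Fin c) ℝ)
    (hSoff : ∀ (i : Fin n) (j : Fin c), (i : ℕ) ≠ (j : ℕ) → S i j = 0)
    (H : Matrix (Fin c) (Fin n) ℝ) :
    (H * S).trace = ∑ i, H i (Fin.castLE hcn i) * S (Fin.castLE hcn i) i := by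
  simp only [Matrix.trace, Matrix.diag, Matrix.mul_apply]
  refine Finset.sum_congr rfl fun i _ => ?_
  refine Finset.sum_eq_single _ (fun j _ hj => ?_) (by simp)
  rw [hSoff j i (fun h => hj (Fin.ext h)), mul_zero]

theorem aux_rect (n c : ℕ) (hcn : c ≤ n) : rectId c n * (rectId c n)ᵀ = 1 := by
  ext i j
  rw [Matrix.mul_apply, Finset.sum_eq_single (Fin.castLE hcn i)]
  · simp [rectId, Matrix.one_apply, Fin.ext_iff, eq_comm]
  · intro k _ hk
    have : (i : ℕ) ≠ k := fun h => hk (Fin.ext h.symm)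
    simp [rectId, this]
  · simp

theorem aux_le (n c : ℕ) (H : Matrix (Fin c) (Fin n) ℝ) (h : H * Hᵀ = 1)
    (i : Fin c) (j : Fin n) : H i j ≤ 1 := by
  have h1 : ∑ k, H i k * H i k = 1 := by
    have := congrFun (congrFun h i) i
    simpa [Matrix.mul_apply] using this
  have h2 : H i j * H i j ≤ ∑ k, H i k * H i k :=
    Finset.single_le_sum (f := fun k => H i k * H i k)
      (fun k _ => mul_self_nonneg _) (Finset.mem_univ j)
  nlinarith

/-- Given `c ≤ n` and an `n × c` real matrix `P` with singular value
decomposition `P = Λ S Vᵀ` (with `Λ ∈ O(n)`, `V ∈ O(c)`, `S` vanishing off the diagonal,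
with nonnegative, nonincreasing diagonal entries), the matrix `G* = V [I_c, 0] Λᵀ`
satisfies `G* (G*)ᵀ = I_c` and maximizes `tr (G P)` over all `c × n` matrices `G` with
`G Gᵀ = I_c`. -/
theorem stmt0 (n c : ℕ) (hcn : c ≤ n)
    (P S : Matrix (Fin n) (Fin c) ℝ)
    (Λ : Matrix (Fin n) (Fin n) ℝ) (V : Matrix (Fin c) (Fin c) ℝ)
    (hΛ₁ : Λ * Λᵀ = 1) (hΛ₂ : Λᵀ * Λ = 1)
    (hV₁ : V * Vᵀ = 1) (hV₂ : Vᵀ * V = 1)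
    (hSoff : ∀ (i : Fin n) (j : Fin c), (i : ℕ) ≠ (j : ℕ) → S i j = 0)
    (hSnonneg : ∀ i : Fin c, 0 ≤ S (Fin.castLE hcn i) i)
    (hSmono : ∀ i j : Fin c, i ≤ j → S (Fin.castLE hcn j) j ≤ S (Fin.castLE hcn i) i)
    (hP : P = Λ * S * Vᵀ) :
    (V * rectId c n * Λᵀ) * (V * rectId c n * Λᵀ)ᵀ = 1 ∧
      ∀ G : Matrix (Fin c) (Fin n) ℝ, G * Gᵀ = 1 →
        (G * P).trace ≤ ((V * rectId c n * Λᵀ) * P).trace := by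
  have key : ∀ G : Matrix (Fin c) (Fin n) ℝ, (G * P).trace = ((Vᵀ * G * Λ) * S).trace := by
    intro G
    rw [hP, ← Matrix.mul_assoc, Matrix.trace_mul_comm]
    simp only [Matrix.mul_assoc]
  refine ⟨?_, fun G hG => ?_⟩
  · calc (V * rectId c n * Λᵀ) * (V * rectId c n * Λᵀ)ᵀ
        = V * (rectId c n * (Λᵀ * Λ) * (rectId c n)ᵀ) * Vᵀ := by
          simp only [Matrix.transpose_mul, Matrix.transpose_transpose, Matrix.mul_assoc]
      _ = 1 := by rw [hΛ₂, Matrix.mul_one, aux_rect n c hcn, Matrix.mul_one, hV₁]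
  · have hH : (Vᵀ * G * Λ) * (Vᵀ * G * Λ)ᵀ = 1 := by
      calc (Vᵀ * G * Λ) * (Vᵀ * G * Λ)ᵀ = Vᵀ * (G * (Λ * Λᵀ) * Gᵀ) * V := by
            simp only [Matrix.transpose_mul, Matrix.transpose_transpose, Matrix.mul_assoc]
        _ = 1 := by rw [hΛ₁, Matrix.mul_one, hG, Matrix.mul_one, hV₂]
    have hE : Vᵀ * (V * rectId c n * Λᵀ) * Λ = rectId c n := by
      calc Vᵀ * (V * rectId c n * Λᵀ) * Λ = (Vᵀ * V) * rectId c n * (Λᵀ * Λ) := by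
            simp only [Matrix.mul_assoc]
        _ = _ := by rw [hV₂, hΛ₂, Matrix.one_mul, Matrix.mul_one]
    rw [key, key, hE, aux_trace n c hcn S hSoff, aux_trace n c hcn S hSoff]
    refine Finset.sum_le_sum fun i _ => mul_le_mul_of_nonneg_right ?_ (hSnonneg i)
    have : rectId c n i (Fin.castLE hcn i) = 1 := by simp [rectId]
    rw [this]
    exact aux_le n c _ hH i _
end

section
/- Let c ≤ n, let P be a real n×c matrix with singular values s₁₁ ≥ … ≥ s_cc ≥ 0. Then for every real c×n matrix G with G Gᵀ = I_c, one has tr(G P) ≤ s₁₁ + s₂₂ + … + s_cc, i.e. tr(G P) is bounded above by the sum of the singular values of P. -/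
open Matrix BigOperators

/-- Let `c ≤ n` and let `P` be an `n × c` real matrix with singular value
decomposition `P = Λ S Vᵀ` (with `Λ ∈ O(n)`, `V ∈ O(c)`, `S` vanishing off the diagonal with
nonnegative, nonincreasing diagonal entries `s₁₁ ≥ … ≥ s_cc ≥ 0`). Then for every real
`c × n` matrix `G` with `G Gᵀ = I_c`, one has `tr (G P) ≤ s₁₁ + s₂₂ + … + s_cc`. -/
theorem stmt1 (n c : ℕ) (hcn : c ≤ n)
    (P S : Matrix (Fin n) (Fin c) ℝ)
    (Λ : Matrix (Fin n) (Fin n) ℝ) (V : Matrix (Fin c) (Fin c) ℝ)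
    (hΛ₁ : Λ * Λᵀ = 1) (hΛ₂ : Λᵀ * Λ = 1)
    (hV₁ : V * Vᵀ = 1) (hV₂ : Vᵀ * V = 1)
    (hSoff : ∀ (i : Fin n) (j : Fin c), (i : ℕ) ≠ (j : ℕ) → S i j = 0)
    (hSnonneg : ∀ i : Fin c, 0 ≤ S (Fin.castLE hcn i) i)
    (hSmono : ∀ i j : Fin c, i ≤ j → S (Fin.castLE hcn j) j ≤ S (Fin.castLE hcn i) i)
    (hP : P = Λ * S * Vᵀ)
    (G : Matrix (Fin c) (Fin n) ℝ) (hG : G * Gᵀ = 1) :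
    (G * P).trace ≤ ∑ i : Fin c, S (Fin.castLE hcn i) i := by
  have hW : (Vᵀ * G * Λ) * (Vᵀ * G * Λ)ᵀ = 1 := by
    calc (Vᵀ * G * Λ) * (Vᵀ * G * Λ)ᵀ = Vᵀ * (G * (Λ * Λᵀ) * Gᵀ) * V := by
          simp only [Matrix.transpose_mul, Matrix.transpose_transpose, Matrix.mul_assoc]
      _ = 1 := by rw [hΛ₁, Matrix.mul_one, hG, Matrix.mul_one, hV₂]
  have htr : (G * P).trace = ((Vᵀ * G * Λ) * S).trace := by
    rw [hP, ← Matrix.mul_assoc, Matrix.trace_mul_comm]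
    simp only [Matrix.mul_assoc]
  rw [htr]
  generalize Vᵀ * G * Λ = W at hW
  have hle : ∀ i k, W i k ≤ 1 := by
    intro i k
    have h1 : ∑ j, W i j * W i j = 1 := by
      have h := congrFun (congrFun hW i) i
      simpa [Matrix.mul_apply] using h
    have h2 : W i k * W i k ≤ ∑ j, W i j * W i j :=
      Finset.single_le_sum (f := fun j => W i j * W i j)
        (fun j _ => mul_self_nonneg _) (Finset.mem_univ k)
    nlinarith
  simp only [Matrix.trace, Matrix.diag_apply, Matrix.mul_apply]
  apply Finset.sum_le_sum
  intro i _
  rw [Finset.sum_eq_single (Fin.castLE hcn i)]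
  · exact mul_le_of_le_one_left (hSnonneg i) (hle _ _)
  · intro j _ hj
    rw [hSoff j i, mul_zero]
    intro h
    exact hj (Fin.ext h)
  · intro h
    exact absurd (Finset.mem_univ _) h
end

section
/- Let c ≤ n and let P = Λ S Vᵀ be an n×c real matrix given by a singular value decomposition with Λ ∈ O(n), V ∈ O(c), and singular values s₁₁, …, s_cc. Then the matrix G* = V [I_c, 0] Λᵀ satisfies tr(G* P) = s₁₁ + s₂₂ + … + s_cc, i.e. G* attains the upper bound given by the sum of the singular values of P. -/
open Matrix BigOperators

/-- Let `c ≤ n` and let `P = Λ S Vᵀ` be an `n × c` real matrix given by a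
singular value decomposition (`Λ ∈ O(n)`, `V ∈ O(c)`, `S` vanishing off the diagonal with
nonnegative singular values `s₁₁, …, s_cc`). Then `G* = V [I_c, 0] Λᵀ` satisfies
`tr (G* P) = s₁₁ + s₂₂ + … + s_cc`. -/
theorem stmt5 (n c : ℕ) (hcn : c ≤ n)
    (P S : Matrix (Fin n) (Fin c) ℝ)
    (Λ : Matrix (Fin n) (Fin n) ℝ) (V : Matrix (Fin c) (Fin c) ℝ)
    (hΛ₁ : Λ * Λᵀ = 1) (hΛ₂ : Λᵀ * Λ = 1)
    (hV₁ : V * Vᵀ = 1) (hV₂ : Vᵀ * V = 1)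
    (hSoff : ∀ (i : Fin n) (j : Fin c), (i : ℕ) ≠ (j : ℕ) → S i j = 0)
    (hSnonneg : ∀ i : Fin c, 0 ≤ S (Fin.castLE hcn i) i)
    (hP : P = Λ * S * Vᵀ) :
    ((V * rectId c n * Λᵀ) * P).trace = ∑ i : Fin c, S (Fin.castLE hcn i) i := by
  have h1 : (V * rectId c n * Λᵀ) * P = V * (rectId c n * S * Vᵀ) := by
    calc (V * rectId c n * Λᵀ) * P = V * (rectId c n * (Λᵀ * Λ) * S * Vᵀ) := by
          rw [hP]; simp only [Matrix.mul_assoc]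
      _ = _ := by rw [hΛ₂, Matrix.mul_one]
  rw [h1, Matrix.trace_mul_comm, Matrix.mul_assoc, hV₂, Matrix.mul_one]
  simp only [Matrix.trace, Matrix.diag_apply]
  refine Finset.sum_congr rfl fun i _ => ?_
  rw [Matrix.mul_apply, Finset.sum_eq_single (Fin.castLE hcn i)]
  · simp [rectId]
  · intro j _ hj
    have hne : (j : ℕ) ≠ (i : ℕ) := fun h => hj (Fin.ext h)
    rw [hSoff j i hne, mul_zero]
  · intro h
    exact absurd (Finset.mem_univ _) h
end

section
/- Let c ≤ n and let M be a real n×c matrix with (thin) singular value decomposition M = U Σ Vᵀ, where U is an n×c matrix with Uᵀ U = I_c, V ∈ O(c), and Σ is the c×c diagonal matrix of singular values σ₁ ≥ … ≥ σ_c ≥ 0. Then for every real n×c matrix G with Gᵀ G = I_c, tr(Gᵀ M) ≤ σ₁ + … + σ_c, and equality is attained at G = U Vᵀ; hence G = U Vᵀ maximizes tr(Gᵀ M) over all n×c matrices G with Gᵀ G = I_c. -/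
open Matrix BigOperators

/-- Let `c ≤ n` and let `M` be a real `n × c` matrix with thin singular value
decomposition `M = U Σ Vᵀ`, where `U` is `n × c` with `Uᵀ U = I_c`, `V ∈ O(c)`, and `Σ` is the
`c × c` diagonal matrix of singular values `σ₁ ≥ … ≥ σ_c ≥ 0`. Then for every real `n × c`
matrix `G` with `Gᵀ G = I_c`, `tr (Gᵀ M) ≤ σ₁ + … + σ_c`, and equality is attained at
`G = U Vᵀ`; hence `G = U Vᵀ` maximizes `tr (Gᵀ M)` over all such `G`. -/
theorem stmt6 (n c : ℕ) (hcn : c ≤ n)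
    (M U : Matrix (Fin n) (Fin c) ℝ)
    (Sig V : Matrix (Fin c) (Fin c) ℝ)
    (hU : Uᵀ * U = 1)
    (hV₁ : V * Vᵀ = 1) (hV₂ : Vᵀ * V = 1)
    (hSigdiag : ∀ i j : Fin c, i ≠ j → Sig i j = 0)
    (hSignonneg : ∀ i : Fin c, 0 ≤ Sig i i)
    (hSigmono : ∀ i j : Fin c, i ≤ j → Sig j j ≤ Sig i i)
    (hM : M = U * Sig * Vᵀ) :
    (∀ G : Matrix (Fin n) (Fin c) ℝ, Gᵀ * G = 1 →
        (Gᵀ * M).trace ≤ ∑ i : Fin c, Sig i i) ∧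
      ((U * Vᵀ)ᵀ * M).trace = ∑ i : Fin c, Sig i i := by
  have key : ∀ G : Matrix (Fin n) (Fin c) ℝ,
      (Gᵀ * M).trace = ∑ i : Fin c, ((G * V)ᵀ * U) i i * Sig i i := by
    intro G
    have h1 : (Gᵀ * M).trace = (((G * V)ᵀ * U) * Sig).trace := by
      rw [hM, ← Matrix.mul_assoc, Matrix.trace_mul_comm, Matrix.transpose_mul]
      simp only [Matrix.mul_assoc]
    rw [h1, Matrix.trace]
    refine Finset.sum_congr rfl fun i _ => ?_
    rw [Matrix.diag_apply, Matrix.mul_apply]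
    refine Finset.sum_eq_single i (fun j _ hj => ?_) (fun h => absurd (Finset.mem_univ i) h)
    rw [hSigdiag j i hj, mul_zero]
  refine ⟨fun G hG => ?_, ?_⟩
  · rw [key G]
    refine Finset.sum_le_sum fun i _ => ?_
    have hH : (G * V)ᵀ * (G * V) = 1 := by
      rw [Matrix.transpose_mul, Matrix.mul_assoc, ← Matrix.mul_assoc Gᵀ, hG, Matrix.one_mul, hV₂]
    generalize G * V = H at hH ⊢
    have a : ∑ k, H k i * H k i = 1 := by
      have := congrFun (congrFun hH i) i
      simpa [Matrix.mul_apply] using this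
    have b : ∑ k, U k i * U k i = 1 := by
      have := congrFun (congrFun hU i) i
      simpa [Matrix.mul_apply] using this
    have hle : (Hᵀ * U) i i ≤ 1 := by
      have h2 : ∑ k, H k i * U k i ≤ ∑ k, (H k i * H k i + U k i * U k i) / 2 :=
        Finset.sum_le_sum fun k _ => by nlinarith [sq_nonneg (H k i - U k i)]
      rw [← Finset.sum_div, Finset.sum_add_distrib, a, b] at h2
      simp only [Matrix.mul_apply, Matrix.transpose_apply]
      linarith
    nlinarith [hSignonneg i]
  · rw [key, Matrix.mul_assoc, hV₂, Matrix.mul_one, hU]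
    simp
end

section
/- Let B be a real symmetric positive semidefinite n×n matrix, let K be a real n×c matrix, and let G be a real n×c matrix with Gᵀ G = I_c. Suppose G⁺ is a real n×c matrix with (G⁺)ᵀ G⁺ = I_c that maximizes the linear functional G' ↦ tr(G'ᵀ (B G + K)) over all n×c matrices G' with (G')ᵀ G' = I_c. Then the objective f(G) = tr(Gᵀ B G) + 2 tr(Gᵀ K) does not decrease under the update: f(G⁺) ≥ f(G). (This is the monotonicity underlying the iterative solution G* = U Vᵀ, where U X Vᵀ is the SVD of B G + K.) -/
open Matrix

/-- Let `B` be a real symmetric positive semidefinite `n × n` matrix, `K` a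
real `n × c` matrix, and `G` a real `n × c` matrix with `Gᵀ G = I_c`. Suppose `G⁺` (with
`(G⁺)ᵀ G⁺ = I_c`) maximizes `G' ↦ tr (G'ᵀ (B G + K))` over all `n × c` matrices `G'` with
`(G')ᵀ G' = I_c`. Then `f(G) = tr (Gᵀ B G) + 2 tr (Gᵀ K)` does not decrease under the update:
`f(G⁺) ≥ f(G)`. -/
theorem stmt7 (n c : ℕ)
    (B : Matrix (Fin n) (Fin n) ℝ) (hB : B.PosSemidef)
    (K G Gplus : Matrix (Fin n) (Fin c) ℝ)
    (hG : Gᵀ * G = 1) (hGplus : Gplusᵀ * Gplus = 1)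
    (hmax : ∀ G' : Matrix (Fin n) (Fin c) ℝ, G'ᵀ * G' = 1 →
      (G'ᵀ * (B * G + K)).trace ≤ (Gplusᵀ * (B * G + K)).trace) :
    (Gᵀ * B * G).trace + 2 * (Gᵀ * K).trace ≤
      (Gplusᵀ * B * Gplus).trace + 2 * (Gplusᵀ * K).trace := by
  have h1 := (hB.conjTranspose_mul_mul_same (Gplus - G)).trace_nonneg
  have hBt : Bᵀ = B := by
    have := hB.isHermitian.eq
    rwa [conjTranspose_eq_transpose_of_trivial] at this
  have h2 := hmax G hG
  have h3 : (Gᵀ * (B * Gplus)).trace = (Gplusᵀ * (B * G)).trace := by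
    rw [← trace_transpose]
    simp only [transpose_mul, transpose_transpose, hBt, Matrix.mul_assoc]
  rw [conjTranspose_eq_transpose_of_trivial] at h1
  simp only [transpose_sub, Matrix.sub_mul, Matrix.mul_sub, Matrix.mul_add, trace_sub, trace_add,
    Matrix.mul_assoc] at h1 h2 ⊢
  linarith
end
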